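/- arXiv:0710.3746 — 4 statements merged into one kernel-verified Lean document; each statement's English description precedes it below -/
import Mathlib

section
/- Let D be a principal ideal domain and A an m×n matrix over D[x] of rank r. Then there exist an m×r matrix P and an r×n matrix Q, both over D[x], such that A = P·Q (a full rank factorization). -/
open Polynomial Matrix

/-- Size of a polynomial: `0` for the zero polynomial, `natDegree + 1` otherwise. -/
noncomputable def polySize {k : Type*} [Field k] (f : k[X]) : ℕ :=
  open Classical in if f = 0 then 0 else f.natDegree + 1

theorem polySize_mod_lt {k : Type*} [Field k] (f g : k[X]) (hg : g ≠ 0)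
    (h : polySize g ≤ polySize f) : polySize (f % g) < polySize f := by
  refine lt_of_lt_of_le ?_ h
  by_cases h0 : f % g = 0
  · simp [polySize, h0, hg]
  · have h1 : (f % g).natDegree < g.natDegree :=
      Polynomial.natDegree_lt_natDegree h0 (EuclideanDomain.mod_lt f hg)
    simp [polySize, h0, hg, h1]

/-- Euclidean reduction, lifted along a surjection onto `k[X]`. -/
theorem euclid_reduce {R k : Type*} [CommRing R] [Field k] (φ : R →+* k[X])
    (hφ : Function.Surjective φ) {m n r : ℕ} :
    ∀ (N : ℕ) (P : Matrix (Fin m) (Fin r) R) (Q : Matrix (Fin r) (Fin n) R)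
      (c : Fin r → k[X]), ∑ i, polySize (c i) = N → c ≠ 0 → (P.map φ) *ᵥ c = 0 →
      ∃ (P' : Matrix (Fin m) (Fin r) R) (Q' : Matrix (Fin r) (Fin n) R) (j : Fin r),
        P' * Q' = P * Q ∧ ∀ i, φ (P' i j) = 0 := by
  intro N
  induction N using Nat.strong_induction_on with
  | _ N ih =>
  intro P Q c hN hc hP
  by_cases h : ∃ i j, i ≠ j ∧ c i ≠ 0 ∧ c j ≠ 0
  · have h' : ∃ i j, i ≠ j ∧ c i ≠ 0 ∧ c j ≠ 0 ∧ polySize (c j) ≤ polySize (c i) := by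
      obtain ⟨i, j, hij, hi, hj⟩ := h
      rcases le_total (polySize (c j)) (polySize (c i)) with h | h
      · exact ⟨i, j, hij, hi, hj, h⟩
      · exact ⟨j, i, hij.symm, hj, hi, h⟩
    obtain ⟨i, j, hij, hi, hj, hle⟩ := h'
    obtain ⟨q, hq⟩ := hφ (c i / c j)
    have hUV : transvection i j q * transvection i j (-q) = 1 := by
      rw [transvection_mul_transvection_same _ _ hij]; simp
    have hUVk : transvection i j (φ q) * transvection i j (-φ q) = 1 := by
      rw [transvection_mul_transvection_same _ _ hij]; simp
    have hVU : transvection i j (-φ q) * transvection i j (φ q) = 1 := by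
      rw [transvection_mul_transvection_same _ _ hij]; simp
    have hmap : (transvection i j q).map φ = transvection i j (φ q) := by
      ext a b
      simp [transvection, Matrix.one_apply, Matrix.single_apply, apply_ite φ]
    set c' : Fin r → k[X] := transvection i j (-φ q) *ᵥ c with hc'
    have hci : c' i = c i % c j := by
      rw [hc', hq, EuclideanDomain.mod_eq_sub_mul_div]
      simp [transvection, Matrix.add_mulVec, Matrix.single_mulVec]
      ring
    have hco : ∀ l, l ≠ i → c' l = c l := by
      intro l hl
      rw [hc']
      simp [transvection, Matrix.add_mulVec, Matrix.single_mulVec, hl]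
    have hlt : ∑ l, polySize (c' l) < N := by
      rw [← hN]
      refine Finset.sum_lt_sum (fun l _ => ?_) ⟨i, Finset.mem_univ _, ?_⟩
      · by_cases hl : l = i
        · subst hl; rw [hci]; exact (polySize_mod_lt _ _ hj hle).le
        · rw [hco l hl]
      · rw [hci]; exact polySize_mod_lt _ _ hj hle
    obtain ⟨P', Q', l, h1, h2⟩ := ih _ hlt (P * transvection i j q)
      (transvection i j (-q) * Q) c' rfl
      (fun h0 => hj (by rw [← hco j hij.symm, h0]; rfl))
      (by
        rw [Matrix.map_mul, hmap, hc', Matrix.mulVec_mulVec, Matrix.mul_assoc, hUVk,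
          Matrix.mul_one, hP])
    refine ⟨P', Q', l, ?_, h2⟩
    rw [h1, Matrix.mul_assoc, ← Matrix.mul_assoc _ _ Q, hUV, Matrix.one_mul]
  · push Not at h
    obtain ⟨j, hj⟩ := Function.ne_iff.mp hc
    refine ⟨P, Q, j, rfl, fun a => ?_⟩
    have h1 := congrFun hP a
    rw [Matrix.mulVec, dotProduct, Finset.sum_eq_single j] at h1
    · simpa [show c j ≠ 0 from hj] using h1
    · intro b _ hb
      have : c b = 0 := by
        by_contra hb0
        exact hj (h b j hb hb0)
      simp [this]
    · simp

/-- If `PQ ≡ 0` modulo `π = ker`, the factor `π` can be removed keeping the inner size. -/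
theorem remove_factor {R k : Type*} [CommRing R] [Field k] (φ : R →+* k[X])
    (hφ : Function.Surjective φ) (π : R) (hker : ∀ f, φ f = 0 → π ∣ f) (hπ : φ π = 0)
    {m n : ℕ} : ∀ (r : ℕ) (P : Matrix (Fin m) (Fin r) R) (Q : Matrix (Fin r) (Fin n) R),
      (P * Q).map φ = 0 →
      ∃ (P' : Matrix (Fin m) (Fin r) R) (Q' : Matrix (Fin r) (Fin n) R),
        P * Q = π • (P' * Q') := by
  intro r
  induction r with
  | zero =>
    intro P Q _
    exact ⟨P, Q, by ext; simp [Matrix.mul_apply]⟩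
  | succ r ih =>
    intro P Q h
    by_cases hc : ∃ c, c ≠ 0 ∧ (P.map φ) *ᵥ c = 0
    · obtain ⟨c, hc0, hc⟩ := hc
      obtain ⟨P1, Q1, j, hPQ, hj⟩ := euclid_reduce φ hφ _ P Q c rfl hc0 hc
      choose v hv using fun i => hker _ (hj i)
      have hsplit : ∀ a b, (P * Q) a b = π * (v a * Q1 j b) +
          (P1.submatrix id j.succAbove * Q1.submatrix j.succAbove id) a b := by
        intro a b
        rw [← hPQ, Matrix.mul_apply, Fin.sum_univ_succAbove _ j, hv, Matrix.mul_apply]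
        simp [mul_assoc]
      obtain ⟨P2, Q2, h2⟩ := ih (P1.submatrix id j.succAbove) (Q1.submatrix j.succAbove id) (by
        ext1 a b
        have h3 := congrFun (congrFun h a) b
        rw [Matrix.map_apply, hsplit, map_add, map_mul, hπ, zero_mul, zero_add] at h3
        exact h3)
      refine ⟨Matrix.of fun a => Fin.cons (v a) (P2 a),
        Matrix.of fun x b => (Fin.cons (Q1 j b) (fun y => Q2 y b) : Fin (r + 1) → R) x, ?_⟩
      ext a b
      rw [hsplit, h2]
      simp [Matrix.mul_apply, Fin.sum_univ_succ, mul_add]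
    · push Not at hc
      have hQ : ∀ i b, π ∣ Q i b := by
        intro i b
        apply hker
        by_contra hne
        refine hc (fun i => φ (Q i b)) (fun h0 => hne (congrFun h0 i)) ?_
        ext1 a
        have h3 := congrFun (congrFun h a) b
        rw [Matrix.map_apply, Matrix.mul_apply, map_sum] at h3
        simpa [Matrix.mulVec, dotProduct] using h3
      choose Q' hQ' using hQ
      refine ⟨P, Matrix.of Q', ?_⟩
      ext a b
      simp only [Matrix.mul_apply, Matrix.smul_apply, smul_eq_mul, Finset.mul_sum, Matrix.of_apply]
      refine Finset.sum_congr rfl fun x _ => ?_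
      rw [hQ']; ring

theorem remove_prime {D : Type*} [CommRing D] [IsDomain D] [IsPrincipalIdealRing D]
    (p : D) (hp : Prime p) {m n r : ℕ} (P : Matrix (Fin m) (Fin r) D[X])
    (Q : Matrix (Fin r) (Fin n) D[X]) (h : ∀ a b, C p ∣ (P * Q) a b) :
    ∃ (P' : Matrix (Fin m) (Fin r) D[X]) (Q' : Matrix (Fin r) (Fin n) D[X]),
        P * Q = C p • (P' * Q') := by
  have hmax : (Ideal.span {p}).IsMaximal :=
    PrincipalIdealRing.isMaximal_of_irreducible hp.irreducible
  letI := Ideal.Quotient.field (Ideal.span {p})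
  have key : ∀ f : D[X], mapRingHom (Ideal.Quotient.mk (Ideal.span {p})) f = 0 ↔ C p ∣ f := by
    intro f
    rw [C_dvd_iff_dvd_coeff, Polynomial.ext_iff]
    simp [Ideal.Quotient.eq_zero_iff_mem, Ideal.mem_span_singleton]
  refine remove_factor (mapRingHom (Ideal.Quotient.mk (Ideal.span {p})))
    (Polynomial.map_surjective _ Ideal.Quotient.mk_surjective) (C p) (fun f hf => (key f).1 hf)
    ((key _).2 dvd_rfl) r P Q ?_
  ext1 a b
  exact (key _).2 (h a b)

theorem remove_all {D : Type*} [CommRing D] [IsDomain D] [IsPrincipalIdealRing D]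
    {m n r : ℕ} (A : Matrix (Fin m) (Fin n) D[X]) (d : D) : d ≠ 0 →
    ∀ (P : Matrix (Fin m) (Fin r) D[X]) (Q : Matrix (Fin r) (Fin n) D[X]),
      C d • A = P * Q →
    ∃ (P' : Matrix (Fin m) (Fin r) D[X]) (Q' : Matrix (Fin r) (Fin n) D[X]), A = P' * Q' := by
  induction d using UniqueFactorizationMonoid.induction_on_prime with
  | h₁ => intro h; exact absurd rfl h
  | h₂ d hd =>
    intro _ P Q h
    obtain ⟨e, he⟩ := hd.exists_left_inv
    refine ⟨C e • P, Q, ?_⟩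
    rw [Matrix.smul_mul, ← h, smul_smul, ← C_mul, he]; simp
  | h₃ d p hd hp ih =>
    intro _ P Q h
    obtain ⟨P', Q', h'⟩ := remove_prime p hp P Q (by
      intro a b
      rw [← h, Matrix.smul_apply, C_mul, smul_eq_mul, mul_assoc]
      exact dvd_mul_right _ _)
    refine ih hd P' Q' ?_
    rw [h', C_mul, ← smul_smul] at h
    ext1 a b
    have h3 := congrFun (congrFun h a) b
    exact mul_left_cancel₀ (C_ne_zero.2 hp.ne_zero) h3

/-- Over a PID, every matrix has a full rank factorization. -/
theorem pid_factor {S : Type*} [CommRing S] [IsDomain S] [IsPrincipalIdealRing S] {m n r : ℕ}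
    (A : Matrix (Fin m) (Fin n) S) (hr : A.rank = r) :
    ∃ (P : Matrix (Fin m) (Fin r) S) (Q : Matrix (Fin r) (Fin n) S), A = P * Q := by
  rw [Matrix.rank_eq_finrank_span_cols] at hr
  let b := Module.finBasisOfFinrankEq S (Submodule.span S (Set.range A.col)) hr
  refine ⟨Matrix.of fun i j => (b j : Fin m → S) i, Matrix.of fun j l =>
    b.repr ⟨A.col l, Submodule.subset_span ⟨l, rfl⟩⟩ j, ?_⟩
  ext a l
  have h := congrArg (fun x : Submodule.span S (Set.range A.col) => (x : Fin m → S) a)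
    (b.sum_repr ⟨A.col l, Submodule.subset_span ⟨l, rfl⟩⟩)
  simp only [Submodule.coe_sum, Finset.sum_apply, Submodule.coe_smul, Pi.smul_apply,
    smul_eq_mul] at h
  rw [Matrix.mul_apply]
  simp only [Matrix.of_apply]
  refine h.symm.trans (Finset.sum_congr rfl fun x _ => mul_comm _ _)

theorem rank_map_localization {R S : Type*} [CommRing R] [CommRing S] [Algebra R S]
    (M : Submonoid R) [IsLocalization M S] (hM : M ≤ nonZeroDivisors R) {m n : ℕ}
    (A : Matrix (Fin m) (Fin n) R) : (A.map (algebraMap R S)).rank = A.rank := by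
  rw [Matrix.rank_eq_finrank_span_cols, Matrix.rank_eq_finrank_span_cols]
  let f : (Fin m → R) →ₗ[R] (Fin m → S) :=
    .pi fun i => (Algebra.linearMap R S) ∘ₗ .proj i
  haveI : IsLocalizedModule M f := inferInstance
  have h1 : Submodule.span S (Set.range (A.map (algebraMap R S)).col) =
      (Submodule.span R (Set.range A.col)).localized' S M f := by
    rw [Submodule.localized'_span, ← Set.range_comp]
    rfl
  rw [h1, IsLocalization.finrank_eq S M hM,
    IsLocalizedModule.finrank_eq M ((Submodule.span R (Set.range A.col)).toLocalized' S M f) hM]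

theorem exists_denominator {D : Type*} [CommRing D] [IsDomain D]
    {m n r : ℕ} (A : Matrix (Fin m) (Fin n) D[X]) (hr : A.rank = r) :
    ∃ d : D, d ≠ 0 ∧ ∃ (P : Matrix (Fin m) (Fin r) D[X]) (Q : Matrix (Fin r) (Fin n) D[X]),
      C d • A = P * Q := by
  let K := FractionRing D
  letI : Algebra D[X] K[X] := Polynomial.algebra D K
  haveI : IsLocalization ((nonZeroDivisors D).map C) K[X] := Polynomial.isLocalization _ _
  have hM : (nonZeroDivisors D).map C ≤ nonZeroDivisors D[X] := by
    rintro _ ⟨d, hd, rfl⟩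
    exact mem_nonZeroDivisors_of_ne_zero (C_ne_zero.2 (nonZeroDivisors.ne_zero hd))
  obtain ⟨P, Q, hPQ⟩ := pid_factor (A.map (algebraMap D[X] K[X]))
    ((rank_map_localization _ hM A).trans hr)
  obtain ⟨⟨_, d, hd, rfl⟩, h1⟩ := IsLocalization.exist_integer_multiples_of_finite
    ((nonZeroDivisors D).map C) (fun x : Fin m × Fin r => P x.1 x.2)
  obtain ⟨⟨_, e, he, rfl⟩, h2⟩ := IsLocalization.exist_integer_multiples_of_finite
    ((nonZeroDivisors D).map C) (fun x : Fin r × Fin n => Q x.1 x.2)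
  choose P' hP' using h1
  choose Q' hQ' using h2
  refine ⟨d * e, mul_ne_zero (nonZeroDivisors.ne_zero hd) (nonZeroDivisors.ne_zero he),
    Matrix.of fun i j => P' (i, j), Matrix.of fun i j => Q' (i, j), ?_⟩
  ext1 a b
  apply IsLocalization.injective K[X] hM
  have h3 := congrFun (congrFun hPQ a) b
  rw [Matrix.map_apply, Matrix.mul_apply] at h3
  rw [Matrix.smul_apply, Matrix.mul_apply, smul_eq_mul, map_mul, h3, map_sum, Finset.mul_sum]
  refine Finset.sum_congr rfl fun x _ => ?_
  simp only [Matrix.of_apply, map_mul, hP', hQ', Algebra.smul_def]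
  exact mul_mul_mul_comm _ _ _ _

/-- Proposition 2.1: every m×n matrix of rank r over D[x]
(D a PID) admits a full rank factorization A = P·Q with P of size m×r and
Q of size r×n. -/
theorem stmt_7 (D : Type*) [CommRing D] [IsDomain D] [IsPrincipalIdealRing D]
    (m n r : ℕ)
    (A : Matrix (Fin m) (Fin n) (Polynomial D))
    (hrank : A.rank = r) :
    ∃ (P : Matrix (Fin m) (Fin r) (Polynomial D))
      (Q : Matrix (Fin r) (Fin n) (Polynomial D)),
      A = P * Q := by
  obtain ⟨d, hd, P, Q, h⟩ := exists_denominator A hrank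
  exact remove_all A d hd P Q h
end

section
/- Let D be a principal ideal domain and A a non-nilpotent square matrix over D[x]. Then A is algebraically strong shift equivalent over D[x] to a nonsingular matrix; moreover the lag can be taken to be l = min{k ∈ ℕ : rank(A^k) = rank(A^{k+1})}. -/
/-- Elementary strong shift equivalence. -/
def ElemSSE (R : Type*) [CommRing R]
    (A B : Σ n : ℕ, Matrix (Fin n) (Fin n) R) : Prop :=
  ∃ (U : Matrix (Fin A.1) (Fin B.1) R) (V : Matrix (Fin B.1) (Fin A.1) R),
    A.2 = U * V ∧ B.2 = V * U

/-- Algebraic strong shift equivalence of lag `l`. -/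
def AlgSSE (R : Type*) [CommRing R] (l : ℕ)
    (A B : Σ n : ℕ, Matrix (Fin n) (Fin n) R) : Prop :=
  ∃ f : ℕ → Σ n : ℕ, Matrix (Fin n) (Fin n) R,
    f 0 = A ∧ f l = B ∧ ∀ i < l, ElemSSE R (f i) (f (i + 1))

section helpers
open Polynomial
open scoped Matrix

lemma rank_map_loc {R : Type*} (S : Type*) [CommRing R] [CommRing S] [Algebra R S]
    (M : Submonoid R) [IsLocalization M S] (hM : M ≤ nonZeroDivisors R) {m n : ℕ}
    (A : Matrix (Fin m) (Fin n) R) : (A.map (algebraMap R S)).rank = A.rank := by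
  let f : (Fin m → R) →ₗ[R] (Fin m → S) :=
    .pi fun i ↦ (Algebra.linearMap R S) ∘ₗ .proj i
  have : IsLocalizedModule M f := inferInstance
  rw [Matrix.rank_eq_finrank_span_cols, Matrix.rank_eq_finrank_span_cols]
  have h1 := IsLocalizedModule.finrank_eq M
    ((Submodule.span R (Set.range A.col)).toLocalized' S M f) hM
  rw [← h1, ← IsLocalization.finrank_eq S M hM, Submodule.localized'_span]
  have : f '' Set.range A.col = Set.range (A.map (algebraMap R S)).col := by
    rw [← Set.range_comp]; rfl
  rw [this]

lemma left_inv_of_rank {F : Type*} [Field F] {n r : ℕ} (U : Matrix (Fin n) (Fin r) F)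
    (h : r ≤ U.rank) : ∃ U' : Matrix (Fin r) (Fin n) F, U' * U = 1 := by
  rw [← Matrix.vecMul_surjective_iff_exists_left_inverse]
  have h2 : Uᵀ.rank = r := by
    rw [Matrix.rank_transpose]; exact le_antisymm (Matrix.rank_le_width U) h
  have h3 : LinearMap.range (Uᵀ.mulVecLin) = ⊤ := by
    apply Submodule.eq_top_of_finrank_eq
    rw [Module.finrank_fin_fun]; exact h2
  rw [LinearMap.range_eq_top] at h3
  intro y
  obtain ⟨x, hx⟩ := h3 y
  exact ⟨x, by rw [← hx, Matrix.mulVecLin_apply, Matrix.mulVec_transpose]⟩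

lemma right_inv_of_rank {F : Type*} [Field F] {n r : ℕ} (V : Matrix (Fin r) (Fin n) F)
    (h : r ≤ V.rank) : ∃ V' : Matrix (Fin n) (Fin r) F, V * V' = 1 := by
  obtain ⟨W, hW⟩ := left_inv_of_rank Vᵀ (by rwa [Matrix.rank_transpose])
  exact ⟨Wᵀ, by rw [← Matrix.transpose_inj, Matrix.transpose_mul]; simpa using hW⟩

lemma pow_succ_factor {R : Type*} [CommRing R] {n r : ℕ} (U : Matrix (Fin n) (Fin r) R)
    (V : Matrix (Fin r) (Fin n) R) (k : ℕ) : (U * V) ^ (k + 1) = U * (V * U) ^ k * V := by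
  induction k with
  | zero => simp
  | succ k ih => rw [pow_succ, ih, pow_succ (V * U)]; simp only [Matrix.mul_assoc]

lemma rank_pow_factor {R : Type*} [CommRing R] [IsDomain R] {n r : ℕ}
    (U : Matrix (Fin n) (Fin r) R) (V : Matrix (Fin r) (Fin n) R) (hr : (U * V).rank = r)
    (k : ℕ) : ((U * V) ^ (k + 1)).rank = ((V * U) ^ k).rank := by
  rw [pow_succ_factor]
  apply le_antisymm
  · exact (Matrix.rank_mul_le_left _ _).trans (Matrix.rank_mul_le_right _ _)
  let F := FractionRing R
  have key : ∀ {m n : ℕ} (A : Matrix (Fin m) (Fin n) R), (A.map (algebraMap R F)).rank = A.rank :=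
    fun A => rank_map_loc F (nonZeroDivisors R) le_rfl A
  obtain ⟨U', hU⟩ := left_inv_of_rank (U.map (algebraMap R F))
    (by rw [key]; exact hr.ge.trans (Matrix.rank_mul_le_left _ _))
  obtain ⟨V', hV⟩ := right_inv_of_rank (V.map (algebraMap R F))
    (by rw [key]; exact hr.ge.trans (Matrix.rank_mul_le_right _ _))
  rw [← key, ← key (U * _ * V), Matrix.map_mul, Matrix.map_mul]
  set B := ((V * U) ^ k).map (algebraMap R F)
  have : B = U' * (U.map (algebraMap R F) * B * V.map (algebraMap R F)) * V' := by
    calc B = (U' * U.map (algebraMap R F)) * B * (V.map (algebraMap R F) * V') := by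
          rw [hU, hV]; simp
      _ = _ := by simp only [Matrix.mul_assoc]
  conv_lhs => rw [this]
  exact (Matrix.rank_mul_le_left _ _).trans (Matrix.rank_mul_le_right _ _)

lemma det_ne_zero_of_rank {R : Type*} [CommRing R] [IsDomain R] {n : ℕ}
    (A : Matrix (Fin n) (Fin n) R) (h : A.rank = n) : A.det ≠ 0 := by
  let F := FractionRing R
  obtain ⟨U', hU⟩ := left_inv_of_rank (A.map (algebraMap R F))
    (by rw [rank_map_loc F (nonZeroDivisors R) le_rfl A, h])
  intro h0
  have h1 := congrArg Matrix.det hU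
  have h2 : (A.map (algebraMap R F)).det = 0 := by
    rw [← RingHom.mapMatrix_apply, ← RingHom.map_det, h0, map_zero]
  rw [Matrix.det_mul, h2] at h1
  simp at h1

lemma rank_set_nonempty {R : Type*} [CommRing R] [IsDomain R] {n : ℕ}
    (A : Matrix (Fin n) (Fin n) R) : {k : ℕ | (A ^ k).rank = (A ^ (k + 1)).rank}.Nonempty := by
  by_contra h
  rw [Set.not_nonempty_iff_eq_empty, Set.eq_empty_iff_forall_notMem] at h
  have h1 : ∀ k, (A ^ k).rank + k ≤ n := by
    intro k
    induction k with
    | zero => simp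
    | succ k ih =>
      have := h k
      simp only [Set.mem_ofPred_eq] at this
      have h2 : (A ^ (k + 1)).rank ≤ (A ^ k).rank := by
        rw [pow_succ]; exact Matrix.rank_mul_le_left _ _
      omega
  have := h1 (n + 1)
  omega

/-- base factorization over K[x] with cleared denominators -/
lemma base_factor (D K : Type*) [CommRing D] [IsDomain D] [Field K] [Algebra D K]
    [IsFractionRing D K] {m n : ℕ}
    (A : Matrix (Fin m) (Fin n) D[X]) :
    ∃ d : D, d ≠ 0 ∧ ∃ (U : Matrix (Fin m) (Fin A.rank) D[X])
      (V : Matrix (Fin A.rank) (Fin n) D[X]), C d • A = U * V := by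
  let _ : Algebra D[X] K[X] := Polynomial.algebra D K
  let M := (nonZeroDivisors D).map (C : D →+* D[X])
  have : IsLocalization M K[X] := Polynomial.isLocalization (nonZeroDivisors D) K
  have hM : M ≤ nonZeroDivisors D[X] := by
    rintro _ ⟨d, hd, rfl⟩
    rw [mem_nonZeroDivisors_iff_ne_zero]
    simpa using nonZeroDivisors.ne_zero hd
  have hinj : Function.Injective (algebraMap D[X] K[X]) := IsLocalization.injective _ hM
  set A' := A.map (algebraMap D[X] K[X]) with hA'
  have hr : A'.rank = A.rank := rank_map_loc K[X] M hM A
  let W := LinearMap.range A'.mulVecLin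
  let b : Module.Basis (Fin A.rank) K[X] W := Module.finBasisOfFinrankEq K[X] W hr
  let U0 : Matrix (Fin m) (Fin A.rank) K[X] := Matrix.of fun i j => (b j : Fin m → K[X]) i
  let V0 : Matrix (Fin A.rank) (Fin n) K[X] := Matrix.of fun j k =>
    b.repr (A'.mulVecLin.rangeRestrict (Pi.single k 1)) j
  have h0 : A' = U0 * V0 := by
    ext1 i k
    have h := congrArg (fun w : W => (w : Fin m → K[X]) i)
      (b.sum_repr (A'.mulVecLin.rangeRestrict (Pi.single k 1)))
    simp only [Submodule.coe_sum, Submodule.coe_smul, Finset.sum_apply, Pi.smul_apply,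
      smul_eq_mul] at h
    have h2 : ((A'.mulVecLin.rangeRestrict (Pi.single k 1) : W) : Fin m → K[X]) i = A' i k := by
      change A'.mulVec (Pi.single k 1) i = _
      rw [Matrix.mulVec_single_one]; rfl
    rw [h2] at h
    rw [Matrix.mul_apply]
    rw [← h]
    exact Finset.sum_congr rfl fun j _ => mul_comm _ _
  obtain ⟨⟨_, d, hd, rfl⟩, hU⟩ := IsLocalization.exist_integer_multiples_of_finite M
    (fun ij : Fin m × Fin A.rank => U0 ij.1 ij.2)
  obtain ⟨⟨_, e, he, rfl⟩, hV⟩ := IsLocalization.exist_integer_multiples_of_finite M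
    (fun ij : Fin A.rank × Fin n => V0 ij.1 ij.2)
  choose u hu using hU
  choose v hv using hV
  refine ⟨d * e, mul_ne_zero (nonZeroDivisors.ne_zero hd) (nonZeroDivisors.ne_zero he),
    Matrix.of fun i j => u (i, j), Matrix.of fun i j => v (i, j), ?_⟩
  ext1 i k
  apply hinj
  have h := congrFun (congrFun h0 i) k
  simp only [hA', Matrix.map_apply, Matrix.mul_apply] at h
  simp only [Matrix.smul_apply, Matrix.mul_apply, Matrix.of_apply, smul_eq_mul, map_mul, map_sum,
    hu, hv, h, Algebra.smul_def, Finset.mul_sum]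
  exact Finset.sum_congr rfl fun j _ => by ring

section
variable {R E : Type*} [CommRing R] [EuclideanDomain E] (φ : R →+* E)

/-- shear -/
def shear {r : ℕ} (q : Fin (r + 1) → R) (hq : q 0 = 0) :
    (Fin (r + 1) → R) ≃ₗ[R] (Fin (r + 1) → R) where
  toFun w := fun i => w i - q i * w 0
  invFun w := fun i => w i + q i * w 0
  map_add' x y := by ext i; simp; ring
  map_smul' c x := by ext i; simp; ring
  left_inv x := by ext i; simp [hq]
  right_inv x := by ext i; simp [hq]

lemma euclid_aux (hφ : Function.Surjective φ) {r : ℕ} (a : E) :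
    ∀ v : Fin (r + 1) → R, φ (v 0) = a → a ≠ 0 →
    ∃ g : (Fin (r + 1) → R) ≃ₗ[R] (Fin (r + 1) → R),
      φ (g v 0) ≠ 0 ∧ ∀ i ≠ 0, φ (g v i) = 0 := by
  refine WellFounded.induction (C := fun a => ∀ v : Fin (r + 1) → R, φ (v 0) = a → a ≠ 0 →
    ∃ g : (Fin (r + 1) → R) ≃ₗ[R] (Fin (r + 1) → R),
      φ (g v 0) ≠ 0 ∧ ∀ i ≠ 0, φ (g v i) = 0) EuclideanDomain.r_wellFounded a ?_
  clear a
  intro a ih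
  intro v hv ha
  choose s hs using hφ
  let q : Fin (r + 1) → R := fun i => if i = 0 then 0 else s (φ (v i) / a)
  have hq : q 0 = 0 := by simp [q]
  have hrem : ∀ i ≠ 0, φ (shear q hq v i) = φ (v i) % a := by
    intro i hi
    simp only [shear, LinearEquiv.coe_mk, LinearMap.coe_mk, AddHom.coe_mk, map_sub, map_mul, q,
      if_neg hi, hs, hv]
    rw [EuclideanDomain.mod_eq_sub_mul_div]; ring
  have hz : φ (shear q hq v 0) = a := by simp [shear, hq, hv]
  by_cases hall : ∀ i ≠ 0, φ (shear q hq v i) = 0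
  · exact ⟨shear q hq, by rwa [hz], hall⟩
  push Not at hall
  obtain ⟨j, hj, hj0⟩ := hall
  let σ : (Fin (r + 1) → R) ≃ₗ[R] (Fin (r + 1) → R) :=
    LinearEquiv.funCongrLeft R R (Equiv.swap 0 j)
  have hσ : σ (shear q hq v) 0 = shear q hq v j := by
    simp [σ, LinearEquiv.funCongrLeft_apply, LinearMap.funLeft_apply]
  obtain ⟨g, hg⟩ := ih (φ (shear q hq v j)) (by rw [hrem j hj]; exact EuclideanDomain.mod_lt _ ha)
    (σ (shear q hq v)) (by rw [hσ]) hj0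
  exact ⟨(shear q hq).trans (σ.trans g), hg⟩

lemma euclid_vec (hφ : Function.Surjective φ) {r : ℕ} (v : Fin (r + 1) → R)
    (hv : ∃ j, φ (v j) ≠ 0) :
    ∃ g : (Fin (r + 1) → R) ≃ₗ[R] (Fin (r + 1) → R),
      φ (g v 0) ≠ 0 ∧ ∀ i ≠ 0, φ (g v i) = 0 := by
  obtain ⟨j, hj⟩ := hv
  let σ : (Fin (r + 1) → R) ≃ₗ[R] (Fin (r + 1) → R) :=
    LinearEquiv.funCongrLeft R R (Equiv.swap 0 j)
  have hσ : σ v 0 = v j := by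
    simp [σ, LinearEquiv.funCongrLeft_apply, LinearMap.funLeft_apply]
  obtain ⟨g, hg⟩ := euclid_aux φ hφ (φ (v j)) (σ v) (by rw [hσ]) hj
  exact ⟨σ.trans g, hg⟩

lemma span_r (hφ : Function.Surjective φ) (π : R) (hπ : ∀ a, φ a = 0 ↔ π ∣ a) (r : ℕ) :
    ∀ L : Submodule R (Fin r → R), (∀ v : Fin r → R, π • v ∈ L) →
      (∀ (a : R) (v : Fin r → R), φ a ≠ 0 → a • v ∈ L → v ∈ L) →
      ∃ T : (Fin r → R) →ₗ[R] (Fin r → R), LinearMap.range T = L := by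
  have hmem : ∀ {r : ℕ} (L : Submodule R (Fin r → R)), (∀ v : Fin r → R, π • v ∈ L) →
      ∀ v : Fin r → R, (∀ i, φ (v i) = 0) → v ∈ L := by
    intro r L hL v hv
    choose w hw using fun i => (hπ (v i)).1 (hv i)
    have : v = π • w := by ext i; simp [hw]
    rw [this]; exact hL w
  induction r with
  | zero =>
    intro L _ _
    refine ⟨0, Subsingleton.elim _ _⟩
  | succ r ih =>
    intro L hL hsat
    by_cases hv : ∀ v ∈ L, ∀ j, φ (v j) = 0
    · refine ⟨π • LinearMap.id, le_antisymm ?_ ?_⟩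
      · rintro _ ⟨v, rfl⟩
        exact hL v
      · intro v hvL
        choose w hw using fun i => (hπ (v i)).1 (hv v hvL i)
        exact ⟨w, by ext i; simp [hw]⟩
    push Not at hv
    obtain ⟨v, hvL, hvj⟩ := hv
    obtain ⟨g, hg0, hg⟩ := euclid_vec φ hφ v hvj
    -- transformed lattice
    let L1 : Submodule R (Fin (r + 1) → R) := L.map (g : (Fin (r + 1) → R) →ₗ[R] _)
    have hL1 : ∀ v : Fin (r + 1) → R, π • v ∈ L1 := fun w => ⟨π • g.symm w, hL _, by simp⟩
    have hsat1 : ∀ (a : R) (v : Fin (r + 1) → R), φ a ≠ 0 → a • v ∈ L1 → v ∈ L1 := by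
      rintro a w ha ⟨u, hu, huw⟩
      refine ⟨g.symm w, hsat a _ ha ?_, by simp⟩
      have : a • g.symm w = u := by
        rw [← map_smul, ← huw]; simp
      rw [this]; exact hu
    have he : (Pi.single 0 1 : Fin (r + 1) → R) ∈ L1 := by
      apply hsat1 (g v 0) _ hg0
      have h1 : g v ∈ L1 := ⟨v, hvL, rfl⟩
      have h2 : g v - g v 0 • (Pi.single 0 1 : Fin (r + 1) → R) ∈ L1 := by
        apply hmem L1 hL1
        intro i
        by_cases hi : i = 0
        · subst hi; simp
        · simp [hi, hg i hi]
      have := L1.sub_mem h1 h2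
      simpa using this
    -- the inclusion of the tail
    let ι : (Fin r → R) →ₗ[R] (Fin (r + 1) → R) :=
      { toFun := fun w => Fin.cons 0 w
        map_add' := fun x y => by
          ext i; refine Fin.cases ?_ (fun i => ?_) i <;> simp
        map_smul' := fun c x => by
          ext i; refine Fin.cases ?_ (fun i => ?_) i <;> simp }
    have hι0 : ∀ w, ι w 0 = 0 := fun w => rfl
    have hιs : ∀ w i, ι w (Fin.succ i) = w i := fun w i => rfl
    obtain ⟨T, hT⟩ := ih (L1.comap ι) (fun w => by
        rw [Submodule.mem_comap, map_smul]; exact hL1 _) (fun a w ha h => by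
        rw [Submodule.mem_comap, map_smul] at h; exact hsat1 a _ ha h)
    let tl : (Fin (r + 1) → R) →ₗ[R] (Fin r → R) := LinearMap.funLeft R R Fin.succ
    let S : (Fin (r + 1) → R) →ₗ[R] (Fin (r + 1) → R) :=
      (LinearMap.proj 0 : (Fin (r + 1) → R) →ₗ[R] R).smulRight (Pi.single 0 1) + ι ∘ₗ T ∘ₗ tl
    have hS : LinearMap.range S = L1 := by
      apply le_antisymm
      · rintro _ ⟨w, rfl⟩
        refine L1.add_mem (L1.smul_mem _ he) ?_
        have : T (tl w) ∈ L1.comap ι := hT ▸ ⟨_, rfl⟩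
        exact this
      · intro w hw
        have hdec : w = w 0 • (Pi.single 0 1 : Fin (r + 1) → R) + ι (tl w) := by
          ext i; refine Fin.cases ?_ (fun i => ?_) i
          · simp [hι0]
          · simp [hιs, tl, LinearMap.funLeft_apply]
        have h1 : tl w ∈ L1.comap ι := by
          rw [Submodule.mem_comap]
          have : ι (tl w) = w - w 0 • (Pi.single 0 1 : Fin (r + 1) → R) := by
            exact eq_sub_of_add_eq' hdec.symm
          rw [this]
          exact L1.sub_mem hw (L1.smul_mem _ he)
        rw [← hT] at h1
        obtain ⟨t, ht⟩ := h1
        refine ⟨Fin.cons (w 0) t, ?_⟩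
        have ht' : tl (Fin.cons (w 0) t) = t := by
          ext i; simp [tl, LinearMap.funLeft_apply]
        conv_rhs => rw [hdec]
        simp [S, ht', ht]
    refine ⟨(g.symm : (Fin (r + 1) → R) →ₗ[R] _) ∘ₗ S, ?_⟩
    rw [LinearMap.range_comp, hS]
    ext w
    simp [L1]

lemma remove_prime_s8 (hφ : Function.Surjective φ) (π : R) (hπ : ∀ a, φ a = 0 ↔ π ∣ a)
    {m n r : ℕ} (A : Matrix (Fin m) (Fin n) R) (U : Matrix (Fin m) (Fin r) R)
    (V : Matrix (Fin r) (Fin n) R) (h : π • A = U * V) :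
    ∃ (U' : Matrix (Fin m) (Fin r) R) (V' : Matrix (Fin r) (Fin n) R), U * V = π • (U' * V') := by
  let L : Submodule R (Fin r → R) :=
    { carrier := {v | ∀ i, φ (U.mulVec v i) = 0}
      add_mem' := fun {a b} ha hb i => by
        simp only [Set.mem_ofPred_eq] at ha hb
        rw [Matrix.mulVec_add, Pi.add_apply, map_add, ha, hb, add_zero]
      zero_mem' := fun i => by simp
      smul_mem' := fun c v hv i => by
        simp only [Set.mem_ofPred_eq] at hv
        rw [Matrix.mulVec_smul, Pi.smul_apply, smul_eq_mul, map_mul, hv, mul_zero] }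
  have hL : ∀ v, v ∈ L ↔ ∀ i, φ (U.mulVec v i) = 0 := fun v => Iff.rfl
  have hπ0 : φ π = 0 := (hπ π).2 dvd_rfl
  obtain ⟨T, hT⟩ := span_r φ hφ π hπ r L
    (fun v => by
      rw [hL]; intro i
      rw [Matrix.mulVec_smul, Pi.smul_apply, smul_eq_mul, map_mul, hπ0, zero_mul])
    (fun a v ha hv => by
      rw [hL] at hv ⊢; intro i
      have := hv i
      rw [Matrix.mulVec_smul, Pi.smul_apply, smul_eq_mul, map_mul] at this
      exact (mul_eq_zero.1 this).resolve_left ha)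
  have hcol : ∀ k, V.col k ∈ LinearMap.range T := by
    intro k
    rw [hT, hL]
    intro i
    have h1 : U.mulVec (V.col k) i = (U * V) i k := rfl
    rw [h1, ← h, Matrix.smul_apply, smul_eq_mul, map_mul, hπ0, zero_mul]
  choose v' hv' using hcol
  have hU : ∀ j i, π ∣ U.mulVec (T (Pi.single j 1)) i := by
    intro j i
    rw [← hπ]
    have : T (Pi.single j 1) ∈ L := hT ▸ ⟨_, rfl⟩
    exact (hL _).1 this i
  choose u hu using hU
  refine ⟨Matrix.of fun i j => u j i, Matrix.of fun j k => v' k j, ?_⟩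
  have hTm : U * LinearMap.toMatrix' T = π • Matrix.of fun i j => u j i := by
    ext1 i j
    rw [Matrix.smul_apply, Matrix.of_apply, smul_eq_mul, ← hu]
    change U.mulVec ((LinearMap.toMatrix' T).col j) i = _
    rw [← Matrix.mulVec_single_one, LinearMap.toMatrix'_mulVec]
  have hV : V = LinearMap.toMatrix' T * Matrix.of fun j k => v' k j := by
    ext1 i k
    change V.col k i = (LinearMap.toMatrix' T).mulVec (v' k) i
    rw [LinearMap.toMatrix'_mulVec, hv']
  conv_lhs => rw [hV]
  rw [← Matrix.mul_assoc, hTm, Matrix.smul_mul]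
end

lemma clear_denom (D : Type*) [CommRing D] [IsDomain D] [IsPrincipalIdealRing D] {m n r : ℕ}
    (A : Matrix (Fin m) (Fin n) D[X]) (d : D) : d ≠ 0 →
    ∀ (U : Matrix (Fin m) (Fin r) D[X]) (V : Matrix (Fin r) (Fin n) D[X]), C d • A = U * V →
    ∃ (U : Matrix (Fin m) (Fin r) D[X]) (V : Matrix (Fin r) (Fin n) D[X]), A = U * V := by
  induction d using UniqueFactorizationMonoid.induction_on_prime with
  | h₁ => intro h; exact absurd rfl h
  | h₂ x hx =>
    intro _ U V h
    obtain ⟨y, hy⟩ := hx.exists_left_inv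
    refine ⟨C y • U, V, ?_⟩
    rw [Matrix.smul_mul, ← h, smul_smul, ← C_mul, hy, C_1, one_smul]
  | h₃ a p ha hp ih =>
    intro _ U V h
    let I := Ideal.span {p}
    have : I.IsMaximal :=
      PrincipalIdealRing.isMaximal_of_irreducible hp.irreducible
    let _ : Field (D ⧸ I) := Ideal.Quotient.field I
    let φ : D[X] →+* (D ⧸ I)[X] := Polynomial.mapRingHom (Ideal.Quotient.mk I)
    have hφ : Function.Surjective φ := Polynomial.map_surjective _ Ideal.Quotient.mk_surjective
    have hπ : ∀ f, φ f = 0 ↔ C p ∣ f := by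
      intro f
      rw [C_dvd_iff_dvd_coeff, Polynomial.ext_iff]
      refine forall_congr' fun i => ?_
      simp only [φ, coe_mapRingHom, coeff_map, coeff_zero]
      rw [Ideal.Quotient.eq_zero_iff_mem, Ideal.mem_span_singleton]
    rw [C_mul, mul_smul] at h
    obtain ⟨U', V', h'⟩ := remove_prime_s8 φ hφ (C p) hπ _ U V h
    refine ih ha U' V' ?_
    rw [h'] at h
    ext1 i j
    have := congrFun (congrFun h i) j
    simp only [Matrix.smul_apply (C p), smul_eq_mul] at this
    exact mul_left_cancel₀ (C_ne_zero.2 hp.ne_zero) this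

lemma rank_factor (D : Type*) [CommRing D] [IsDomain D] [IsPrincipalIdealRing D] {m n : ℕ}
    (A : Matrix (Fin m) (Fin n) D[X]) :
    ∃ (U : Matrix (Fin m) (Fin A.rank) D[X]) (V : Matrix (Fin A.rank) (Fin n) D[X]),
      A = U * V := by
  obtain ⟨d, hd, U, V, h⟩ := base_factor D (FractionRing D) A
  exact clear_denom D A d hd U V h

lemma main_aux (D : Type*) [CommRing D] [IsDomain D] [IsPrincipalIdealRing D] (l : ℕ) :
    ∀ (n : ℕ) (A : Matrix (Fin n) (Fin n) D[X]),
      sInf {k : ℕ | (A ^ k).rank = (A ^ (k + 1)).rank} = l →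
    ∃ (p : ℕ) (B : Matrix (Fin p) (Fin p) D[X]), B.det ≠ 0 ∧ AlgSSE D[X] l ⟨n, A⟩ ⟨p, B⟩ := by
  induction l with
  | zero =>
    intro n A h
    have h0 := Nat.sInf_mem (rank_set_nonempty A)
    rw [h] at h0
    have h1 : A.rank = n := by
      simpa using (show (A ^ 0).rank = (A ^ (0 + 1)).rank from h0).symm
    exact ⟨n, A, det_ne_zero_of_rank A h1, fun _ => ⟨n, A⟩, rfl, rfl, fun i hi => by omega⟩
  | succ l ih =>
    intro n A h
    obtain ⟨U, V, hUV⟩ := rank_factor D A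
    have hrk : ∀ k, (A ^ (k + 1)).rank = ((V * U) ^ k).rank := fun k => by
      have := rank_pow_factor U V (by rw [← hUV]) k
      rwa [← hUV] at this
    have hmem := Nat.sInf_mem (rank_set_nonempty A)
    rw [h] at hmem
    have hB : sInf {k : ℕ | ((V * U) ^ k).rank = ((V * U) ^ (k + 1)).rank} = l := by
      apply le_antisymm
      · apply Nat.sInf_le
        change _ = _
        rw [← hrk, ← hrk]; exact hmem
      · have h2 := Nat.sInf_mem (rank_set_nonempty (V * U))
        set s := sInf {k : ℕ | ((V * U) ^ k).rank = ((V * U) ^ (k + 1)).rank}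
        change ((V * U) ^ s).rank = ((V * U) ^ (s + 1)).rank at h2
        rw [← hrk, ← hrk] at h2
        have h3 : sInf {k : ℕ | (A ^ k).rank = (A ^ (k + 1)).rank} ≤ s + 1 := Nat.sInf_le h2
        omega
    obtain ⟨p, B, hdet, f, hf0, hfl, hf⟩ := ih _ (V * U) hB
    refine ⟨p, B, hdet, fun i => Nat.casesOn i ⟨n, A⟩ f, rfl, hfl, ?_⟩
    intro i hi
    cases i with
    | zero =>
      change ElemSSE D[X] ⟨n, A⟩ (f 0)
      rw [hf0]
      exact ⟨U, V, hUV, rfl⟩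
    | succ i => exact hf i (by omega)

end helpers

/-- Theorem 1.1: every non-nilpotent square matrix over D[x]
(D a PID) is algebraically strong shift equivalent, with lag
l = min{k : rank(A^k) = rank(A^{k+1})}, to a nonsingular matrix. -/
theorem stmt_8 (D : Type*) [CommRing D] [IsDomain D] [IsPrincipalIdealRing D]
    (n : ℕ) (A : Matrix (Fin n) (Fin n) (Polynomial D))
    (hA : ¬ IsNilpotent A) :
    ∃ (p : ℕ) (B : Matrix (Fin p) (Fin p) (Polynomial D)),
      B.det ≠ 0 ∧
      AlgSSE (Polynomial D)
        (sInf {k : ℕ | (A ^ k).rank = (A ^ (k + 1)).rank}) ⟨n, A⟩ ⟨p, B⟩ := by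
  exact main_aux D _ n A rfl
end

section
/- Let R = ℝ[x,y,z]/(x²+y²+z²−1) and σ: R³ → R the R-module map (a,b,c) ↦ ax + by + cz. Then σ is surjective, ker(σ) ⊕ R ≅ R³, and ker(σ) is a finitely generated projective R-module that is not free. -/
open MvPolynomial in
/-- The coordinate ring R = ℝ[x,y,z]/(x² + y² + z² − 1) of the 2-sphere. -/
noncomputable abbrev SphereRing : Type :=
  MvPolynomial (Fin 3) ℝ ⧸
    Ideal.span {(X 0 : MvPolynomial (Fin 3) ℝ) ^ 2 + X 1 ^ 2 + X 2 ^ 2 - 1}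

open MvPolynomial in
noncomputable def xq : SphereRing := Ideal.Quotient.mk _ (X 0)
open MvPolynomial in
noncomputable def yq : SphereRing := Ideal.Quotient.mk _ (X 1)
open MvPolynomial in
noncomputable def zq : SphereRing := Ideal.Quotient.mk _ (X 2)

lemma const_of_exp_const {A : Type*} [TopologicalSpace A] [PreconnectedSpace A] (u : A → ℂ)
    (hu : Continuous u) (c : ℂ) (h : ∀ a, Complex.exp (u a) = c) (a b : A) : u a = u b := by
  have := Complex.isCoveringMap_exp.eq_of_comp_eq (g₁ := u) (g₂ := fun _ => u b) hu
    continuous_const (by funext t; apply Subtype.ext; simp [h]) b rfl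
  exact congrFun this a

lemma exists_cont_log (g : ℝ × ℝ → ℂ) (hg : Continuous g) (h0 : ∀ a, g a ≠ 0) :
    ∃ F : ℝ × ℝ → ℂ, Continuous F ∧ ∀ a, Complex.exp (F a) = g a := by
  obtain ⟨F, ⟨-, hF⟩, -⟩ := Complex.isCoveringMapOn_exp.existsUnique_continuousMap_lifts
    ⟨g, hg⟩ (a₀ := (0, 0)) (e₀ := Complex.log (g (0, 0))) (Complex.exp_log (h0 _))
    (fun a => by simpa using h0 a)
  exact ⟨F, F.continuous, fun a => congrFun hF a⟩

/-- The hairy ball theorem in dimension two. -/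
lemma hairy (w : (Fin 3 → ℝ) → Fin 3 → ℝ) (hw : Continuous w)
    (ht : ∀ p : Fin 3 → ℝ, p 0 ^ 2 + p 1 ^ 2 + p 2 ^ 2 = 1 →
      w p 0 * p 0 + w p 1 * p 1 + w p 2 * p 2 = 0)
    (hn : ∀ p : Fin 3 → ℝ, p 0 ^ 2 + p 1 ^ 2 + p 2 ^ 2 = 1 →
      ¬ (w p 0 = 0 ∧ w p 1 = 0 ∧ w p 2 = 0)) : False := by
  let P : ℝ × ℝ → Fin 3 → ℝ := fun a =>
    ![Real.sin a.1 * Real.cos a.2, Real.sin a.1 * Real.sin a.2, Real.cos a.1]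
  have hP : Continuous P := by
    refine continuous_pi fun i => ?_
    fin_cases i <;> simp [P] <;> fun_prop
  have hPs : ∀ a, P a 0 ^ 2 + P a 1 ^ 2 + P a 2 ^ 2 = 1 := by
    intro a
    simp only [P, Matrix.cons_val]
    linear_combination Real.sin a.1 ^ 2 * Real.sin_sq_add_cos_sq a.2 + Real.sin_sq_add_cos_sq a.1
  have hwc : ∀ i, Continuous fun a => w (P a) i := fun i =>
    (continuous_apply i).comp (hw.comp hP)
  let A : ℝ × ℝ → ℝ := fun a => - w (P a) 0 * Real.sin a.2 + w (P a) 1 * Real.cos a.2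
  let B : ℝ × ℝ → ℝ := fun a => w (P a) 0 * (Real.cos a.1 * Real.cos a.2)
    + w (P a) 1 * (Real.cos a.1 * Real.sin a.2) - w (P a) 2 * Real.sin a.1
  have hA : Continuous A := by
    have h0 := hwc 0
    have h1 := hwc 1
    fun_prop
  have hB : Continuous B := by
    have h0 := hwc 0
    have h1 := hwc 1
    have h2 := hwc 2
    fun_prop
  have hnz : ∀ a, (A a : ℂ) + B a * Complex.I ≠ 0 := by
    intro a h
    have e1 : A a = 0 := by simpa using congrArg Complex.re h
    have e2 : B a = 0 := by simpa using congrArg Complex.im h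
    have e3 := ht (P a) (hPs a)
    apply hn (P a) (hPs a)
    simp only [A, B] at e1 e2
    generalize w (P a) = v at *
    simp only [P, Matrix.cons_val] at e3
    have c1 := Real.sin_sq_add_cos_sq a.1
    have c2 := Real.sin_sq_add_cos_sq a.2
    generalize Real.sin a.1 = s at *
    generalize Real.cos a.1 = c at *
    generalize Real.sin a.2 = s' at *
    generalize Real.cos a.2 = c' at *
    have k : v 0 * c' + v 1 * s' = 0 := by
      linear_combination s * e3 + c * e2 - (v 0 * c' + v 1 * s') * c1
    refine ⟨?_, ?_, ?_⟩
    · linear_combination c' * k - s' * e1 - v 0 * c2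
    · linear_combination s' * k + c' * e1 - v 1 * c2
    · linear_combination c * e3 - s * e2 - v 2 * c1
  obtain ⟨F, hF, hFe⟩ := exists_cont_log (fun a => (A a : ℂ) + B a * Complex.I)
    (by fun_prop) hnz
  -- periodicity
  have hper : ∀ a b : ℝ × ℝ, F (a.1, a.2 + 2 * Real.pi) - F a = F (b.1, b.2 + 2 * Real.pi) - F b := by
    refine const_of_exp_const (fun a : ℝ × ℝ => F (a.1, a.2 + 2 * Real.pi) - F a) (by fun_prop) 1 ?_
    intro a
    rw [Complex.exp_sub, hFe, hFe, div_eq_one_iff_eq (hnz a)]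
    simp [A, B, P]
  have h0 : F (0, 2 * Real.pi) - (2 * Real.pi : ℝ) * Complex.I = F (0, 0) - (0 : ℝ) * Complex.I := by
    refine const_of_exp_const (fun t : ℝ => F (0, t) - t * Complex.I) (by fun_prop)
      ((w ![0, 0, 1] 1 : ℂ) + w ![0, 0, 1] 0 * Complex.I) ?_ (2 * Real.pi) 0
    intro t
    rw [Complex.exp_sub, hFe, div_eq_iff (Complex.exp_ne_zero _), Complex.exp_mul_I]
    simp only [A, B, P]
    simp
    linear_combination (-(w ![0, 0, 1] 0 : ℂ) * Complex.sin t) * Complex.I_sq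
  have hpi : F (Real.pi, 2 * Real.pi) + (2 * Real.pi : ℝ) * Complex.I
      = F (Real.pi, 0) + (0 : ℝ) * Complex.I := by
    refine const_of_exp_const (fun t : ℝ => F (Real.pi, t) + t * Complex.I) (by fun_prop)
      ((w ![0, 0, -1] 1 : ℂ) - w ![0, 0, -1] 0 * Complex.I) ?_ (2 * Real.pi) 0
    intro t
    rw [Complex.exp_add, hFe, Complex.exp_mul_I]
    simp only [A, B, P]
    simp
    have := Complex.sin_sq_add_cos_sq t
    linear_combination (-(w ![0, 0, -1] 0 : ℂ) * Complex.I + w ![0, 0, -1] 1) * this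
      + (-(w ![0, 0, -1] 0 : ℂ) * Complex.cos t * Complex.sin t - w ![0, 0, -1] 1 * Complex.sin t ^ 2) * Complex.I_sq
  have := hper (0, 0) (Real.pi, 0)
  simp only [zero_add] at this
  have h4 : (4 * Real.pi : ℂ) * Complex.I = 0 := by
    push_cast at h0 hpi
    linear_combination this - h0 + hpi
  simp [Real.pi_ne_zero] at h4

open MvPolynomial in
noncomputable def evS (p : Fin 3 → ℝ) (hp : p 0 ^ 2 + p 1 ^ 2 + p 2 ^ 2 = 1) :
    SphereRing →+* ℝ :=
  Ideal.Quotient.lift _ (MvPolynomial.eval p) (by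
    intro a ha
    rw [← RingHom.mem_ker]
    refine (Ideal.span_le (I := RingHom.ker (MvPolynomial.eval p))).2 ?_ ha
    simp [RingHom.mem_ker, hp])

lemma sphere_rel : xq * xq + yq * yq + zq * zq = 1 := by
  have : (Ideal.Quotient.mk (Ideal.span {(MvPolynomial.X 0 : MvPolynomial (Fin 3) ℝ) ^ 2
      + MvPolynomial.X 1 ^ 2 + MvPolynomial.X 2 ^ 2 - 1})) (MvPolynomial.X 0 ^ 2
      + MvPolynomial.X 1 ^ 2 + MvPolynomial.X 2 ^ 2 - 1) = 0 :=
    Ideal.Quotient.eq_zero_iff_mem.2 (Ideal.subset_span rfl)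
  simp only [map_sub, map_add, map_pow, map_one] at this
  unfold xq yq zq
  linear_combination this

lemma split_aux {R M : Type*} [CommRing R] [AddCommGroup M] [Module R M] (σ : M →ₗ[R] R)
    (v : M) (hv : σ v = 1) :
    (∃ ρ : M →ₗ[R] LinearMap.ker σ, ρ ∘ₗ (LinearMap.ker σ).subtype = LinearMap.id) ∧
    Nonempty ((LinearMap.ker σ × R) ≃ₗ[R] M) := by
  let ρ : M →ₗ[R] LinearMap.ker σ :=
    LinearMap.codRestrict _ (LinearMap.id - σ.smulRight v) (by
      intro f
      simp [hv])
  have hρc : ∀ f, ((ρ f : LinearMap.ker σ) : M) = f - σ f • v := fun f => rfl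
  refine ⟨⟨ρ, ?_⟩, ⟨LinearEquiv.ofLinearMap
      (LinearMap.coprod (LinearMap.ker σ).subtype
        (LinearMap.toSpanSingleton _ _ v)) (LinearMap.prod ρ σ) ?_ ?_⟩⟩
  · ext f
    have := LinearMap.mem_ker.1 f.2
    simp [hρc]
  · refine LinearMap.ext fun f => ?_
    simp [hρc]
  · refine LinearMap.ext fun k => ?_
    obtain ⟨k, r⟩ := k
    have hk := LinearMap.mem_ker.1 k.2
    refine Prod.ext (Subtype.ext ?_) ?_
    · simp [hρc, hv]
    · simp [hv]

/-- the map σ : R³ → R, (a,b,c) ↦ ax + by + cz is surjective,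
ker σ ⊕ R ≅ R³, and ker σ is a finitely generated projective R-module that is
not free. -/
theorem stmt_18 (σ : (Fin 3 → SphereRing) →ₗ[SphereRing] SphereRing)
    (hσ : ∀ f : Fin 3 → SphereRing, σ f = f 0 * xq + f 1 * yq + f 2 * zq) :
    Function.Surjective σ ∧
    Nonempty ((LinearMap.ker σ × SphereRing) ≃ₗ[SphereRing] (Fin 3 → SphereRing)) ∧
    Module.Finite SphereRing (LinearMap.ker σ) ∧
    Module.Projective SphereRing (LinearMap.ker σ) ∧
    ¬ Module.Free SphereRing (LinearMap.ker σ) := by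
  obtain ⟨v, hv⟩ : ∃ v, σ v = 1 := ⟨![xq, yq, zq], by rw [hσ]; simpa using sphere_rel⟩
  obtain ⟨⟨ρ, hρ⟩, hprod⟩ := split_aux σ v hv
  have hρs : Function.Surjective ρ := fun k => ⟨k, LinearMap.congr_fun hρ k⟩
  refine ⟨fun r => ⟨r • v, by rw [map_smul, hv, smul_eq_mul, mul_one]⟩, hprod,
    Module.Finite.of_surjective ρ hρs, Module.Projective.of_split _ ρ hρ, ?_⟩
  · intro hfree
    let b := Module.Free.chooseBasis SphereRing (LinearMap.ker σ)
    have hne : Nonempty (Module.Free.ChooseBasisIndex SphereRing (LinearMap.ker σ)) := by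
      by_contra hem
      rw [not_nonempty_iff] at hem
      have hs : Subsingleton (LinearMap.ker σ) := b.repr.toEquiv.subsingleton
      have hm : ![yq, -xq, 0] ∈ LinearMap.ker σ := by
        rw [LinearMap.mem_ker, hσ]; simp; ring
      have := congrArg Subtype.val (Subsingleton.elim (⟨_, hm⟩ : LinearMap.ker σ) 0)
      have h1 : -xq = 0 := congrFun this 1
      have h2 := congrArg (evS ![1, 0, 0] (by simp)) h1
      simp [evS, xq] at h2
    obtain ⟨i⟩ := hne
    let f : Fin 3 → SphereRing := b i
    have hf : f 0 * xq + f 1 * yq + f 2 * zq = 0 := by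
      rw [← hσ]; exact LinearMap.mem_ker.1 (b i).2
    let ℓ : (Fin 3 → SphereRing) →ₗ[SphereRing] SphereRing := b.coord i ∘ₗ ρ
    have hℓ : ℓ f = 1 := by
      have : ρ f = b i := LinearMap.congr_fun hρ (b i)
      simp [ℓ, this]
    have hℓ2 : ℓ f = ∑ j, f j * ℓ (Pi.single j 1) := by
      conv_lhs => rw [pi_eq_sum_univ' f]
      simp [map_sum]
    choose q hq using fun j => Ideal.Quotient.mk_surjective (f j)
    have hev : ∀ p hp j, evS p hp (f j) = MvPolynomial.eval p (q j) := by
      intro p hp j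
      rw [← hq j]; rfl
    refine hairy (fun p j => MvPolynomial.eval p (q j)) ?_ ?_ ?_
    · exact continuous_pi fun j => MvPolynomial.continuous_eval (q j)
    · intro p hp
      have := congrArg (evS p hp) hf
      simp only [map_add, map_mul, hev, map_zero] at this
      simpa [evS, xq, yq, zq] using this
    · rintro p hp ⟨h0, h1, h2⟩
      have := congrArg (evS p hp) (hℓ2.symm.trans hℓ)
      simp [Fin.sum_univ_three, hev, h0, h1, h2] at this
end

section
/- The matrix A over ℝ[x,y,z] with rows (0, z, −y), (−z, 0, x), (y, −x, 0) is not algebraically shift equivalent over ℝ[x,y,z] to any nonsingular square matrix. -/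
open MvPolynomial in
/-- The matrix A over ℝ[x,y,z] with rows (0, z, −y), (−z, 0, x), (y, −x, 0). -/
noncomputable def Apoly : Matrix (Fin 3) (Fin 3) (MvPolynomial (Fin 3) ℝ) :=
  !![0, X 2, -X 1; -X 2, 0, X 0; X 1, -X 0, 0]

/-- Algebraic shift equivalence of lag `l` over a commutative ring. -/
def AlgSE (R : Type*) [CommRing R] {m n : ℕ} (l : ℕ)
    (A : Matrix (Fin m) (Fin m) R) (B : Matrix (Fin n) (Fin n) R) : Prop :=
  ∃ (U : Matrix (Fin m) (Fin n) R) (V : Matrix (Fin n) (Fin m) R),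
    A * U = U * B ∧ V * A = B * V ∧ A ^ l = U * V ∧ B ^ l = V * U

/-- A continuous function on the line whose exponential is constant is constant. -/
theorem const_of_exp (f : ℝ → ℂ) (hf : Continuous f)
    (h : ∀ s t, Complex.exp (f s) = Complex.exp (f t)) (s t : ℝ) : f s = f t :=
  Complex.isCoveringMap_exp.const_of_comp hf (fun a b => Subtype.ext (h a b)) s t

/-- A continuous nowhere zero function on the plane has a continuous logarithm. -/
theorem exists_log (h : ℝ × ℝ → ℂ) (hc : Continuous h) (h0 : ∀ q, h q ≠ 0) :
    ∃ g : ℝ × ℝ → ℂ, Continuous g ∧ ∀ q, Complex.exp (g q) = h q := by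
  obtain ⟨F, ⟨-, hF⟩, -⟩ := Complex.isCoveringMap_exp.existsUnique_continuousMap_lifts
    (⟨fun q => ⟨h q, h0 q⟩, by fun_prop⟩ : C(ℝ × ℝ, {z : ℂ // z ≠ 0})) (0, 0)
    (Complex.log (h (0, 0))) (Subtype.ext (Complex.exp_log (h0 _)))
  refine ⟨F, F.continuous, fun q => ?_⟩
  have := congrFun hF q
  exact congrArg Subtype.val this

/-- Hairy ball theorem on the 2-sphere. -/
theorem hairy_ball (w : (Fin 3 → ℝ) → Fin 3 → ℝ) (hw : Continuous w)
    (htan : ∀ p : Fin 3 → ℝ, p 0 ^ 2 + p 1 ^ 2 + p 2 ^ 2 = 1 →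
      p 0 * w p 0 + p 1 * w p 1 + p 2 * w p 2 = 0)
    (hne : ∀ p : Fin 3 → ℝ, p 0 ^ 2 + p 1 ^ 2 + p 2 ^ 2 = 1 → w p ≠ 0) : False := by
  let P : ℝ × ℝ → Fin 3 → ℝ := fun q =>
    ![Real.sin q.1 * Real.cos q.2, Real.sin q.1 * Real.sin q.2, Real.cos q.1]
  have hP : Continuous P := by
    refine continuous_pi fun i => ?_
    fin_cases i <;> simp [P] <;> fun_prop
  have hPs : ∀ q, P q 0 ^ 2 + P q 1 ^ 2 + P q 2 ^ 2 = 1 := by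
    intro q
    have h1 := Real.sin_sq_add_cos_sq q.1
    have h2 := Real.sin_sq_add_cos_sq q.2
    simp only [P, Matrix.cons_val]
    linear_combination h1 + Real.sin q.1 ^ 2 * h2
  let a : ℝ × ℝ → ℝ := fun q => w (P q) 0 * Real.cos q.1 * Real.cos q.2
    + w (P q) 1 * Real.cos q.1 * Real.sin q.2 - w (P q) 2 * Real.sin q.1
  let b : ℝ × ℝ → ℝ := fun q => - w (P q) 0 * Real.sin q.2 + w (P q) 1 * Real.cos q.2
  have hwi : ∀ i, Continuous fun q => w (P q) i := fun i =>
    (continuous_apply i).comp (hw.comp hP)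
  have hw0 := hwi 0
  have hw1 := hwi 1
  have hw2 := hwi 2
  have ha : Continuous a := by fun_prop
  have hb : Continuous b := by fun_prop
  have hab : ∀ q, (a q : ℂ) + b q * Complex.I ≠ 0 := by
    intro q h
    have ha0 : a q = 0 := by simpa using congrArg Complex.re h
    have hb0 : b q = 0 := by simpa using congrArg Complex.im h
    apply hne (P q) (hPs q)
    have hc := htan (P q) (hPs q)
    have h1 := Real.sin_sq_add_cos_sq q.1
    have h2 := Real.sin_sq_add_cos_sq q.2
    simp only [a, b] at ha0 hb0
    have e0 : P q 0 = Real.sin q.1 * Real.cos q.2 := rfl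
    have e1 : P q 1 = Real.sin q.1 * Real.sin q.2 := rfl
    have e2 : P q 2 = Real.cos q.1 := rfl
    rw [e0, e1, e2] at hc
    have k2 : w (P q) 2 = 0 := by
      linear_combination Real.cos q.1 * hc - Real.sin q.1 * ha0 - w (P q) 2 * h1
    have kr : w (P q) 0 * Real.cos q.2 + w (P q) 1 * Real.sin q.2 = 0 := by
      linear_combination Real.sin q.1 * hc + Real.cos q.1 * ha0
        - (w (P q) 0 * Real.cos q.2 + w (P q) 1 * Real.sin q.2) * h1
    have k0 : w (P q) 0 = 0 := by
      linear_combination Real.cos q.2 * kr - Real.sin q.2 * hb0 - w (P q) 0 * h2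
    have k1 : w (P q) 1 = 0 := by
      linear_combination Real.sin q.2 * kr + Real.cos q.2 * hb0 - w (P q) 1 * h2
    ext i
    fin_cases i
    · exact k0
    · exact k1
    · exact k2
  obtain ⟨g, hg, hge⟩ := exists_log (fun q => (a q : ℂ) + b q * Complex.I) (by fun_prop) hab
  -- at the north pole
  have hN : ∀ t, Complex.exp (g (0, t) + t * Complex.I)
      = (w ![0, 0, 1] 0 : ℂ) + w ![0, 0, 1] 1 * Complex.I := by
    intro t
    have hPt : P (0, t) = ![0, 0, 1] := by simp [P]
    have h2 : (Complex.sin t) ^ 2 + Complex.cos t ^ 2 = 1 := Complex.sin_sq_add_cos_sq _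
    rw [Complex.exp_add, hge, Complex.exp_mul_I]
    simp only [a, b, hPt, Real.sin_zero, Real.cos_zero]
    push_cast
    linear_combination ((w ![0, 0, 1] 0 : ℂ) + w ![0, 0, 1] 1 * Complex.I) * h2
      + (-(w ![0, 0, 1] 0 : ℂ) * Complex.sin t ^ 2
        + (w ![0, 0, 1] 1 : ℂ) * Complex.cos t * Complex.sin t) * Complex.I_sq
  have hS : ∀ t, Complex.exp (g (Real.pi, t) - t * Complex.I)
      = -(w ![0, 0, -1] 0 : ℂ) + w ![0, 0, -1] 1 * Complex.I := by
    intro t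
    have hPt : P (Real.pi, t) = ![0, 0, -1] := by simp [P]
    have h2 : (Complex.sin t) ^ 2 + Complex.cos t ^ 2 = 1 := Complex.sin_sq_add_cos_sq _
    rw [sub_eq_add_neg, Complex.exp_add, hge, ← neg_mul, Complex.exp_mul_I, Complex.cos_neg,
      Complex.sin_neg]
    simp only [a, b, hPt, Real.sin_pi, Real.cos_pi]
    push_cast
    linear_combination (-(w ![0, 0, -1] 0 : ℂ) + w ![0, 0, -1] 1 * Complex.I) * h2
      + ((w ![0, 0, -1] 0 : ℂ) * Complex.sin t ^ 2
        - (w ![0, 0, -1] 1 : ℂ) * Complex.cos t * Complex.sin t) * Complex.I_sq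
  have cN := const_of_exp (fun t => g (0, t) + t * Complex.I) (by fun_prop)
    (fun s t => by rw [hN, hN]) 0 (2 * Real.pi)
  have cS := const_of_exp (fun t => g (Real.pi, t) - t * Complex.I) (by fun_prop)
    (fun s t => by rw [hS, hS]) 0 (2 * Real.pi)
  have hper : ∀ s, Complex.exp (g (s, 2 * Real.pi) - g (s, 0)) = 1 := by
    intro s
    have hPt : P (s, 2 * Real.pi) = P (s, 0) := by simp [P]
    rw [Complex.exp_sub, hge, hge, div_eq_one_iff_eq (hab _)]
    simp only [a, b, hPt, Real.sin_two_pi, Real.cos_two_pi, Real.sin_zero, Real.cos_zero]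
  have cD := const_of_exp (fun s => g (s, 2 * Real.pi) - g (s, 0)) (by fun_prop)
    (fun s t => by rw [hper, hper]) 0 Real.pi
  push_cast at cN cS
  have : (Real.pi : ℂ) * Complex.I = 0 := by
    linear_combination (-1/4 : ℂ) * cN + (1/4 : ℂ) * cS - (1/4 : ℂ) * cD
  simp [Real.pi_ne_zero] at this

open MvPolynomial in
/-- The polynomial `x² + y² + z²`. -/
noncomputable def rpoly : MvPolynomial (Fin 3) ℝ := X 0 ^ 2 + X 1 ^ 2 + X 2 ^ 2

theorem Apoly_cube : Apoly * Apoly * Apoly + rpoly • Apoly = 0 := by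
  ext1 i j
  fin_cases i <;> fin_cases j <;>
    simp [Apoly, rpoly, Matrix.mul_apply, Fin.sum_univ_three] <;> ring

theorem vec_Apoly : Matrix.vecMul (fun i => MvPolynomial.X i) Apoly = 0 := by
  ext1 j
  fin_cases j <;>
    simp [Apoly, Matrix.vecMul, dotProduct, Fin.sum_univ_three] <;> ring

/-- Theorem 1.2: A is not algebraically shift equivalent over
ℝ[x,y,z] to any nonsingular matrix. -/
theorem stmt_19 :
    ¬ ∃ (n : ℕ) (B : Matrix (Fin n) (Fin n) (MvPolynomial (Fin 3) ℝ)) (l : ℕ),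
        B.det ≠ 0 ∧ AlgSE (MvPolynomial (Fin 3) ℝ) l Apoly B := by
  rintro ⟨n, B, l, hB, U, V, hAU, -, hA, hBl⟩
  have hreg : ∀ (k : ℕ) (N : Matrix (Fin n) (Fin n) (MvPolynomial (Fin 3) ℝ)),
      B ^ k * N = 0 → N = 0 := by
    intro k N h
    have hd : (B ^ k).det ≠ 0 := by rw [Matrix.det_pow]; exact pow_ne_zero _ hB
    exact (Matrix.isRegular_of_isLeftRegular_det
      (IsLeftCancelMulZero.mul_left_cancel_of_ne_zero hd)).left (by simpa using h)
  have hU3 : U * (B * (B * B + rpoly • 1)) = 0 := by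
    have : U * (B * (B * B + rpoly • 1)) = (Apoly * Apoly * Apoly + rpoly • Apoly) * U := by
      simp only [Matrix.mul_add, Matrix.add_mul, Matrix.mul_assoc, Matrix.mul_smul,
        Matrix.smul_mul, Matrix.mul_one, hAU]
      simp only [← Matrix.mul_assoc, hAU]
    rw [this, Apoly_cube, Matrix.zero_mul]
  have hB2 : B * B + rpoly • 1 = 0 := by
    apply hreg (l + 1)
    rw [pow_succ, hBl, Matrix.mul_assoc, Matrix.mul_assoc, hU3, Matrix.mul_zero]
  have hBB : B * B = -(rpoly • (1 : Matrix (Fin n) (Fin n) (MvPolynomial (Fin 3) ℝ))) :=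
    eq_neg_of_add_eq_zero_left hB2
  have hr0 : rpoly ≠ 0 := by
    intro h
    have := congrArg (MvPolynomial.eval ![1, 0, 0]) h
    simp [rpoly] at this
  have htan : Matrix.vecMul (fun i => MvPolynomial.X i) U = 0 := by
    have h1 : Matrix.vecMul (fun i => MvPolynomial.X i) (U * (B * B)) = 0 := by
      rw [← Matrix.mul_assoc, ← hAU, Matrix.mul_assoc, ← Matrix.vecMul_vecMul, vec_Apoly,
        Matrix.zero_vecMul]
    rw [hBB, Matrix.mul_neg, Matrix.mul_smul, Matrix.mul_one, Matrix.vecMul_neg,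
      Matrix.vecMul_smul, neg_eq_zero] at h1
    exact (smul_eq_zero.mp h1).resolve_left hr0
  rcases Nat.eq_zero_or_pos n with hn | hn
  · subst hn
    have hAl : Apoly ^ l = 0 := by
      rw [hA]; ext i j; simp [Matrix.mul_apply]
    have key : ∀ k : ℕ, Apoly ^ (2 * k + 1) = (-rpoly) ^ k • Apoly := by
      intro k
      induction k with
      | zero => simp
      | succ k ih =>
        have h3 : Apoly * (Apoly * Apoly) = -(rpoly • Apoly) := by
          rw [← Matrix.mul_assoc]; exact eq_neg_of_add_eq_zero_left Apoly_cube
        rw [show 2 * (k + 1) + 1 = (2 * k + 1) + 1 + 1 by ring, pow_succ, pow_succ, ih,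
          Matrix.smul_mul, Matrix.smul_mul, Matrix.mul_assoc, h3, pow_succ, mul_smul, neg_smul]
    have h0 := key l
    rw [show 2 * l + 1 = l + (l + 1) by ring, pow_add, hAl, zero_mul] at h0
    rcases smul_eq_zero.mp h0.symm with h | h
    · exact pow_ne_zero l (neg_ne_zero.mpr hr0) h
    · have := congrFun (congrFun h 0) 1
      exact MvPolynomial.X_ne_zero (R := ℝ) (2 : Fin 3) (by simpa [Apoly] using this)
  · let j : Fin n := ⟨0, hn⟩
    refine hairy_ball (fun p i => MvPolynomial.eval p (U i j)) ?_ ?_ ?_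
    · exact continuous_pi fun i => MvPolynomial.continuous_eval _
    · intro p _
      have h := congrArg (MvPolynomial.eval p) (congrFun htan j)
      simpa [Matrix.vecMul, dotProduct, Fin.sum_univ_three] using h
    · intro p hp h0
      let e := MvPolynomial.eval p
      have hr : e rpoly = 1 := by simpa [e, rpoly] using hp
      have hb : (B.map e) * (B.map e) = -1 := by
        have := congrArg (fun M => M.map e) hBB
        simp only [Matrix.map_mul] at this
        rw [this]
        ext a b
        by_cases hab : a = b <;> simp [hr, hab, Matrix.one_apply]
      have hunit : IsUnit (B.map e) := by
        refine IsUnit.of_mul_eq_one (-(B.map e)) ?_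
        rw [Matrix.mul_neg, hb, neg_neg]
      have hbl : (B.map e) ^ l = V.map e * U.map e := by
        rw [← Matrix.map_mul, ← hBl, Matrix.map_pow]
      have hcol : ((B.map e) ^ l).mulVec (Pi.single j 1) = 0 := by
        rw [hbl, ← Matrix.mulVec_mulVec]
        have : (U.map e).mulVec (Pi.single j 1) = 0 := by
          rw [Matrix.mulVec_single_one]
          ext i
          exact congrFun h0 i
        rw [this, Matrix.mulVec_zero]
      have hinj := Matrix.mulVec_injective_of_isUnit (hunit.pow l)
      have := hinj (hcol.trans (Matrix.mulVec_zero _).symm)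
      simpa using congrFun this j
end
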